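/- Let p > 0 and β > −1. For every s > 0 and every x ∈ ℝ² with x ≠ 0, one has 𝒟_β^[p](s : x) = s^(β+2/p) · p^(β+1) · Γ(1/p)² · J_{β+1}^[p](2π s^(1/p) x) / (2π s^(1/p) |x|_p)^(β+1). -/

import Mathlib

open Real MeasureTheory

/-- The `p`-norm of a point of `ℝ²`. -/
noncomputable def pnorm (p : ℝ) (x : ℝ × ℝ) : ℝ := (|x.1| ^ p + |x.2| ^ p) ^ (1 / p)

/-- The generalized Bessel function of order zero `J₀^[p]`. -/
noncomputable def Jzero (p : ℝ) (η : ℝ × ℝ) : ℝ :=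
  (1 / Real.Gamma (1 / p) ^ 2) * (2 / p) ^ 2 *
    ∫ t in (0:ℝ)..1,
      Real.cos (η.1 * t ^ (1 / p)) * Real.cos (η.2 * (1 - t) ^ (1 / p)) *
        t ^ (1 / p - 1) * (1 - t) ^ (1 / p - 1)

/-- The generalized Bessel function of positive order `J_ω^[p]`. -/
noncomputable def Jord (p ω : ℝ) (η : ℝ × ℝ) : ℝ :=
  pnorm p η ^ ω / (p ^ (ω - 1) * Real.Gamma ω) *
    ∫ τ in (0:ℝ)..1, Jzero p (τ * η.1, τ * η.2) * τ * (1 - τ ^ p) ^ (ω - 1)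

/-- `e^{2πiθ}`. -/
noncomputable def e2πi (θ : ℝ) : ℂ := Complex.exp (((2 * Real.pi * θ : ℝ) : ℂ) * Complex.I)

/-- The integral version `𝒟_β^[p](s : x)`. -/
noncomputable def Dcal (p β s : ℝ) (x : ℝ × ℝ) : ℂ :=
  ((1 / Real.Gamma (β + 1) : ℝ) : ℂ) *
    ∫ ξ in {ξ : ℝ × ℝ | pnorm p ξ ^ p < s},
      (((s - pnorm p ξ ^ p) ^ β : ℝ) : ℂ) * e2πi (x.1 * ξ.1 + x.2 * ξ.2)

/-- The lattice sum version `D_β^[p](s : x)`. -/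
noncomputable def Dlat (p β s : ℝ) (x : ℝ × ℝ) : ℂ :=
  ((1 / Real.Gamma (β + 1) : ℝ) : ℂ) *
    ∑' m : ℤ × ℤ,
      if pnorm p ((m.1 : ℝ), (m.2 : ℝ)) ^ p < s then
        (((s - pnorm p ((m.1 : ℝ), (m.2 : ℝ)) ^ p) ^ β : ℝ) : ℂ) *
          e2πi (x.1 * (m.1 : ℝ) + x.2 * (m.2 : ℝ))
      else 0

theorem pnorm_rpow {p : ℝ} (hp : p ≠ 0) (x : ℝ × ℝ) :
    pnorm p x ^ p = |x.1| ^ p + |x.2| ^ p := by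
  rw [pnorm, ← rpow_mul (by positivity), one_div_mul_cancel hp, rpow_one]

theorem pnorm_mul {p : ℝ} (hp : p ≠ 0) {c : ℝ} (hc : 0 ≤ c) (x : ℝ × ℝ) :
    pnorm p (c * x.1, c * x.2) = c * pnorm p x := by
  simp only [pnorm, abs_mul, abs_of_nonneg hc]
  rw [mul_rpow hc (abs_nonneg _), mul_rpow hc (abs_nonneg _), ← mul_add,
    mul_rpow (by positivity) (by positivity), ← rpow_mul hc, mul_one_div_cancel hp, rpow_one]

theorem pnorm_pos {p : ℝ} {x : ℝ × ℝ} (hx : x ≠ 0) : 0 < pnorm p x := by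
  refine rpow_pos_of_pos ?_ _
  by_cases h : x.1 = 0
  · have h2 : x.2 ≠ 0 := fun h2 => hx (Prod.ext h h2)
    have := rpow_pos_of_pos (abs_pos.2 h2) p
    positivity
  · have := rpow_pos_of_pos (abs_pos.2 h) p
    positivity

theorem integrableOn_rpow_mul_one_sub_rpow {a b : ℝ} (ha : -1 < a) (hb : -1 < b) :
    IntegrableOn (fun t : ℝ => t ^ a * (1 - t) ^ b) (Set.Ioo 0 1) := by
  have h := Complex.betaIntegral_convergent (u := ((a + 1 : ℝ) : ℂ)) (v := ((b + 1 : ℝ) : ℂ))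
    (by rw [Complex.ofReal_re]; linarith) (by rw [Complex.ofReal_re]; linarith)
  rw [intervalIntegrable_iff_integrableOn_Ioo_of_le zero_le_one] at h
  refine IntegrableOn.congr_fun (f := fun t : ℝ => RCLike.re _) h.re (fun t ht => ?_)
    measurableSet_Ioo
  have e1 : (((a + 1 : ℝ) : ℂ) - 1) = (a : ℂ) := by push_cast; ring
  have e2 : (((b + 1 : ℝ) : ℂ) - 1) = (b : ℂ) := by push_cast; ring
  have e3 : (1 - (t : ℂ)) = ((1 - t : ℝ) : ℂ) := by push_cast; ring
  simp only [e1, e2, e3]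
  rw [← Complex.ofReal_cpow ht.1.le, ← Complex.ofReal_cpow (by linarith [ht.2]),
    ← Complex.ofReal_mul]
  rfl

theorem exists_mul_one_sub_le_one_sub_rpow {p : ℝ} (hp : 0 < p) :
    ∃ c > 0, ∀ t ∈ Set.Ioo (0 : ℝ) 1, c * (1 - t) ≤ 1 - t ^ p := by
  rcases le_total p 1 with h | h
  · refine ⟨p, hp, fun t ht => ?_⟩
    have := rpow_one_add_le_one_add_mul_self (s := t - 1) (by linarith [ht.1]) hp.le h
    rw [add_sub_cancel] at this
    linarith
  · refine ⟨1, one_pos, fun t ht => ?_⟩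
    have := rpow_le_rpow_of_exponent_ge ht.1 ht.2.le h
    rw [rpow_one] at this
    linarith

theorem integrableOn_mul_one_sub_rpow_rpow {p β : ℝ} (hp : 0 < p) (hβ : -1 < β) :
    IntegrableOn (fun t : ℝ => t * (1 - t ^ p) ^ β) (Set.Ioo 0 1) := by
  obtain ⟨c, hc, h⟩ := exists_mul_one_sub_le_one_sub_rpow hp
  have hint : IntegrableOn (fun t : ℝ => 1 + c ^ β * (t ^ (0 : ℝ) * (1 - t) ^ β)) (Set.Ioo 0 1) :=
    (integrableOn_const (by simp)).add
      ((integrableOn_rpow_mul_one_sub_rpow (by norm_num) hβ).const_mul _)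
  refine hint.mono' (by fun_prop) ?_
  filter_upwards [ae_restrict_mem measurableSet_Ioo] with t ht
  have hpos : 0 < 1 - t ^ p := by linarith [rpow_lt_one ht.1.le ht.2 hp]
  have hle : 1 - t ^ p ≤ 1 := by linarith [rpow_pos_of_pos ht.1 p]
  have h1 : 0 < 1 - t := by linarith [ht.2]
  have h0 := rpow_pos_of_pos hpos β
  rw [norm_of_nonneg (mul_nonneg ht.1.le h0.le), rpow_zero, one_mul,
    ← mul_rpow hc.le h1.le]
  refine (mul_le_of_le_one_left h0.le ht.2.le).trans ?_
  rcases le_total 0 β with hb | hb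
  · have := rpow_le_one hpos.le hle hb
    have := rpow_nonneg (mul_pos hc h1).le β
    linarith
  · have := rpow_le_rpow_of_nonpos (mul_pos hc h1) (h t ht) hb
    linarith

/-- Folding an integral along a measure-preserving map `σ` exchanging `S` and its complement. -/
theorem integral_eq_setIntegral_add_comp {X E : Type*} [MeasurableSpace X] [NormedAddCommGroup E]
    [NormedSpace ℝ E] {μ : Measure X} {σ : X → X} (hσ : MeasurePreserving σ μ μ)
    (hemb : MeasurableEmbedding σ) {S : Set X} (hS : MeasurableSet S)
    (hSσ : σ ⁻¹' Sᶜ =ᵐ[μ] S) {φ : X → E} (h₁ : IntegrableOn φ S μ)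
    (h₂ : IntegrableOn (fun x => φ (σ x)) S μ) :
    Integrable φ μ ∧ ∫ x, φ x ∂μ = ∫ x in S, (φ x + φ (σ x)) ∂μ := by
  have h₃ : IntegrableOn φ Sᶜ μ := by
    rw [← hσ.integrableOn_comp_preimage hemb]
    exact h₂.congr_set_ae hSσ
  have h : Integrable φ μ := by
    rw [← integrableOn_univ, ← Set.union_compl_self S]
    exact h₁.union h₃
  refine ⟨h, ?_⟩
  rw [← integral_add_compl hS h, integral_add h₁ h₂, ← hσ.setIntegral_preimage_emb hemb φ Sᶜ,
    setIntegral_congr_set hSσ]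

/-- Splitting an integral over a set symmetric under both reflections into the four quadrants. -/
theorem setIntegral_eq_quadrant {E : Type*} [NormedAddCommGroup E] [NormedSpace ℝ E]
    {A : Set (ℝ × ℝ)} (hA : MeasurableSet A) (hA₁ : ∀ x y, (-x, y) ∈ A ↔ (x, y) ∈ A)
    (hA₂ : ∀ x y, (x, -y) ∈ A ↔ (x, y) ∈ A) {φ : ℝ × ℝ → E}
    (hφ : ∀ ε δ : ℝ, |ε| = 1 → |δ| = 1 →
      IntegrableOn (fun z => φ (ε * z.1, δ * z.2)) (A ∩ Set.Ioi 0 ×ˢ Set.Ioi 0)) :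
    ∫ z in A, φ z = ∫ z in A ∩ Set.Ioi 0 ×ˢ Set.Ioi 0,
      (φ z + φ (z.1, -z.2) + (φ (-z.1, z.2) + φ (-z.1, -z.2))) := by
  have m₁ : MeasurePreserving (fun z : ℝ × ℝ => (-z.1, z.2)) volume volume :=
    (Measure.measurePreserving_neg (volume : Measure ℝ)).prod (.id volume)
  have m₂ : MeasurePreserving (fun z : ℝ × ℝ => (z.1, -z.2)) volume volume :=
    (MeasurePreserving.id (volume : Measure ℝ)).prod (Measure.measurePreserving_neg volume)
  have e₁ : MeasurableEmbedding (fun z : ℝ × ℝ => (-z.1, z.2)) :=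
    ((MeasurableEquiv.neg ℝ).prodCongr (.refl ℝ)).measurableEmbedding
  have e₂ : MeasurableEmbedding (fun z : ℝ × ℝ => (z.1, -z.2)) :=
    ((MeasurableEquiv.refl ℝ).prodCongr (.neg ℝ)).measurableEmbedding
  have mS₁ : MeasurableSet {z : ℝ × ℝ | 0 < z.1} := measurableSet_lt (by fun_prop) (by fun_prop)
  have mS₂ : MeasurableSet {z : ℝ × ℝ | 0 < z.2} := measurableSet_lt (by fun_prop) (by fun_prop)
  have n₁ : ∀ᵐ z : ℝ × ℝ, z.1 ≠ 0 :=
    Measure.quasiMeasurePreserving_fst.ae (Measure.ae_ne volume (0 : ℝ))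
  have n₂ : ∀ᵐ z : ℝ × ℝ, z.2 ≠ 0 :=
    Measure.quasiMeasurePreserving_snd.ae (Measure.ae_ne volume (0 : ℝ))
  have r₁ : MeasurePreserving (fun z : ℝ × ℝ => (-z.1, z.2)) (volume.restrict A)
      (volume.restrict A) := by
    have := m₁.restrict_preimage hA
    rwa [show (fun z : ℝ × ℝ => (-z.1, z.2)) ⁻¹' A = A from Set.ext fun z => hA₁ z.1 z.2] at this
  have r₂ : MeasurePreserving (fun z : ℝ × ℝ => (z.1, -z.2))
      (volume.restrict ({z | 0 < z.1} ∩ A)) (volume.restrict ({z | 0 < z.1} ∩ A)) := by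
    have := m₂.restrict_preimage (mS₁.inter hA)
    rwa [show (fun z : ℝ × ℝ => (z.1, -z.2)) ⁻¹' ({z | 0 < z.1} ∩ A) = {z | 0 < z.1} ∩ A from
      Set.ext fun z => and_congr Iff.rfl (hA₂ z.1 z.2)] at this
  have s₁ : (fun z : ℝ × ℝ => (-z.1, z.2)) ⁻¹' {z | 0 < z.1}ᶜ
      =ᵐ[volume.restrict A] {z : ℝ × ℝ | 0 < z.1} := by
    filter_upwards [ae_restrict_of_ae n₁] with z hz
    refine propext ?_
    change ¬ (0 < -z.1) ↔ 0 < z.1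
    grind
  have s₂ : (fun z : ℝ × ℝ => (z.1, -z.2)) ⁻¹' {z | 0 < z.2}ᶜ
      =ᵐ[volume.restrict ({z | 0 < z.1} ∩ A)] {z : ℝ × ℝ | 0 < z.2} := by
    filter_upwards [ae_restrict_of_ae n₂] with z hz
    refine propext ?_
    change ¬ (0 < -z.2) ↔ 0 < z.2
    grind
  have hQ : {z : ℝ × ℝ | 0 < z.2} ∩ ({z | 0 < z.1} ∩ A) = A ∩ Set.Ioi 0 ×ˢ Set.Ioi 0 := by
    ext z
    simp only [Set.mem_inter_iff, Set.mem_ofPred_eq, Set.mem_prod, Set.mem_Ioi]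
    tauto
  have key : ∀ ψ : ℝ × ℝ → E, IntegrableOn ψ (A ∩ Set.Ioi 0 ×ˢ Set.Ioi 0) →
      IntegrableOn (fun z => ψ (z.1, -z.2)) (A ∩ Set.Ioi 0 ×ˢ Set.Ioi 0) →
      IntegrableOn ψ ({z | 0 < z.1} ∩ A) ∧ ∫ z in {z | 0 < z.1} ∩ A, ψ z =
        ∫ z in A ∩ Set.Ioi 0 ×ˢ Set.Ioi 0, (ψ z + ψ (z.1, -z.2)) := by
    intro ψ i₁ i₂
    have := integral_eq_setIntegral_add_comp r₂ e₂ mS₂ s₂ (φ := ψ)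
      (by rwa [IntegrableOn, Measure.restrict_restrict mS₂, hQ])
      (by rwa [IntegrableOn, Measure.restrict_restrict mS₂, hQ])
    rwa [Measure.restrict_restrict mS₂, hQ] at this
  have i₁ := hφ 1 1 (by simp) (by simp)
  have i₂ := hφ 1 (-1) (by simp) (by simp)
  have i₃ := hφ (-1) 1 (by simp) (by simp)
  have i₄ := hφ (-1) (-1) (by simp) (by simp)
  simp only [one_mul, neg_one_mul] at i₁ i₂ i₃ i₄
  have k₁ := key φ i₁ i₂
  have k₂ := key (fun z => φ (-z.1, z.2)) i₃ i₄
  have := integral_eq_setIntegral_add_comp r₁ e₁ mS₁ s₁ (φ := φ)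
    (by rw [IntegrableOn, Measure.restrict_restrict mS₁]; exact k₁.1)
    (by rw [IntegrableOn, Measure.restrict_restrict mS₁]; exact k₂.1)
  rw [this.2, Measure.restrict_restrict mS₁, integral_add k₁.1 k₂.1, k₁.2, k₂.2]
  exact (integral_add (i₁.add i₂) (i₃.add i₄)).symm

/-- Polar coordinates adapted to the `p`-ball of radius `s ^ (1 / p)` in the first quadrant. -/
noncomputable def pPolar (p s : ℝ) (z : ℝ × ℝ) : ℝ × ℝ :=
  (s ^ (1 / p) * (z.1 * z.2 ^ (1 / p)), s ^ (1 / p) * (z.1 * (1 - z.2) ^ (1 / p)))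

/-- The derivative of `pPolar`, see `hasFDerivAt_pPolar`. -/
noncomputable def fderivPPolar (p s : ℝ) (z : ℝ × ℝ) : ℝ × ℝ →L[ℝ] ℝ × ℝ :=
  (Matrix.toLin (.finTwoProd ℝ) (.finTwoProd ℝ)
    !![s ^ (1 / p) * z.2 ^ (1 / p), s ^ (1 / p) * (z.1 * (1 / p * z.2 ^ (1 / p - 1)));
      s ^ (1 / p) * (1 - z.2) ^ (1 / p),
      -(s ^ (1 / p) * (z.1 * (1 / p * (1 - z.2) ^ (1 / p - 1))))]).toContinuousLinearMap

theorem hasFDerivAt_pPolar (p s : ℝ) {z : ℝ × ℝ} (hz : z ∈ Set.Ioo (0 : ℝ) 1 ×ˢ Set.Ioo (0 : ℝ) 1) :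
    HasFDerivAt (pPolar p s) (fderivPPolar p s z) z := by
  obtain ⟨-, h0, h1⟩ := hz
  unfold fderivPPolar
  rw [Matrix.toLin_finTwoProd_toContinuousLinearMap]
  have d₁ : HasDerivAt (fun t : ℝ => t ^ (1 / p)) (1 / p * z.2 ^ (1 / p - 1)) z.2 :=
    hasDerivAt_rpow_const (Or.inl h0.ne')
  have d₂ : HasDerivAt (fun t : ℝ => (1 - t) ^ (1 / p)) (-(1 / p * (1 - z.2) ^ (1 / p - 1))) z.2 := by
    have := (hasDerivAt_rpow_const (x := 1 - z.2) (p := 1 / p)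
      (Or.inl (sub_pos.2 h1).ne')).comp_const_sub 1 z.2
    exact this
  convert! HasFDerivAt.prodMk (𝕜 := ℝ)
    ((hasFDerivAt_fst.mul (d₁.comp_hasFDerivAt z hasFDerivAt_snd)).const_mul (s ^ (1 / p)))
    ((hasFDerivAt_fst.mul (d₂.comp_hasFDerivAt z hasFDerivAt_snd)).const_mul (s ^ (1 / p))) using 2 <;>
  simp [smul_smul, add_comm, smul_neg, neg_smul _ (ContinuousLinearMap.snd ℝ ℝ ℝ)]

theorem abs_det_fderivPPolar {p s : ℝ} (hp : 0 < p) (hs : 0 < s) {z : ℝ × ℝ}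
    (hz : z ∈ Set.Ioo (0 : ℝ) 1 ×ˢ Set.Ioo (0 : ℝ) 1) :
    |(fderivPPolar p s z).det| =
      s ^ (2 / p) / p * (z.1 * (z.2 ^ (1 / p - 1) * (1 - z.2) ^ (1 / p - 1))) := by
  obtain ⟨⟨h0, -⟩, h1, h2⟩ := hz
  have h3 : 0 < 1 - z.2 := sub_pos.2 h2
  have e1 : z.2 ^ (1 / p) = z.2 * z.2 ^ (1 / p - 1) := by
    rw [rpow_sub_one h1.ne']; field_simp
  have e2 : (1 - z.2) ^ (1 / p) = (1 - z.2) * (1 - z.2) ^ (1 / p - 1) := by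
    rw [rpow_sub_one h3.ne']; field_simp
  have e3 : s ^ (2 / p) = s ^ (1 / p) * s ^ (1 / p) := by
    rw [← rpow_add hs]; ring_nf
  unfold fderivPPolar
  simp only [LinearMap.det_toContinuousLinearMap, LinearMap.det_toLin, Matrix.det_fin_two_of]
  rw [e1, e2, e3, ← abs_neg, abs_of_nonneg]
  · field_simp
    ring
  · rw [show ∀ a b c d e f g : ℝ, -(a * (b * c) * -(a * (d * (e * f))) - a * (d * (e * c)) * (a * (g * f)))
      = a * a * d * e * c * f * (b + g) by intros; ring]
    have := rpow_pos_of_pos h1 (1 / p - 1)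
    have := rpow_pos_of_pos h3 (1 / p - 1)
    have := rpow_pos_of_pos hs (1 / p)
    positivity

theorem pPolar_rpow {p s : ℝ} (hp : 0 < p) (hs : 0 < s) {z : ℝ × ℝ}
    (hz : z ∈ Set.Ioo (0 : ℝ) 1 ×ˢ Set.Ioo (0 : ℝ) 1) :
    (pPolar p s z).1 ^ p = s * (z.1 ^ p * z.2) ∧
      (pPolar p s z).2 ^ p = s * (z.1 ^ p * (1 - z.2)) := by
  obtain ⟨⟨h0, -⟩, h1, h2⟩ := hz
  have h3 : 0 < 1 - z.2 := sub_pos.2 h2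
  have hR := rpow_pos_of_pos hs (1 / p)
  constructor <;> simp only [pPolar]
  · rw [mul_rpow hR.le (by positivity), mul_rpow h0.le (by positivity), ← rpow_mul hs.le,
      ← rpow_mul h1.le, one_div_mul_cancel hp.ne', rpow_one, rpow_one]
  · rw [mul_rpow hR.le (by positivity), mul_rpow h0.le (by positivity), ← rpow_mul hs.le,
      ← rpow_mul h3.le, one_div_mul_cancel hp.ne', rpow_one, rpow_one]

theorem pPolar_pos {p s : ℝ} (hs : 0 < s) {z : ℝ × ℝ}
    (hz : z ∈ Set.Ioo (0 : ℝ) 1 ×ˢ Set.Ioo (0 : ℝ) 1) :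
    0 < (pPolar p s z).1 ∧ 0 < (pPolar p s z).2 := by
  obtain ⟨⟨h0, -⟩, h1, h2⟩ := hz
  have h3 : 0 < 1 - z.2 := sub_pos.2 h2
  constructor <;> simp only [pPolar] <;> positivity

theorem pnorm_pPolar_rpow {p s : ℝ} (hp : 0 < p) (hs : 0 < s) {z : ℝ × ℝ}
    (hz : z ∈ Set.Ioo (0 : ℝ) 1 ×ˢ Set.Ioo (0 : ℝ) 1) :
    pnorm p (pPolar p s z) ^ p = s * z.1 ^ p := by
  obtain ⟨h1, h2⟩ := pPolar_pos (p := p) hs hz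
  obtain ⟨h3, h4⟩ := pPolar_rpow hp hs hz
  rw [pnorm_rpow hp.ne', abs_of_pos h1, abs_of_pos h2, h3, h4]
  ring

theorem injOn_pPolar {p s : ℝ} (hp : 0 < p) (hs : 0 < s) :
    Set.InjOn (pPolar p s) (Set.Ioo (0 : ℝ) 1 ×ˢ Set.Ioo (0 : ℝ) 1) := by
  intro z hz w hw h
  have h1 : s * z.1 ^ p = s * w.1 ^ p := by
    rw [← pnorm_pPolar_rpow hp hs hz, ← pnorm_pPolar_rpow hp hs hw, h]
  have h2 := (pPolar_rpow hp hs hz).1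
  rw [h, (pPolar_rpow hp hs hw).1, ← mul_assoc, ← mul_assoc, h1] at h2
  have h3 : z.1 = w.1 :=
    (rpow_left_inj hz.1.1.le hw.1.1.le hp.ne').1 (mul_left_cancel₀ hs.ne' h1)
  exact Prod.ext h3 (mul_left_cancel₀ (mul_pos hs (rpow_pos_of_pos hw.1.1 p)).ne' h2).symm

theorem image_pPolar {p s : ℝ} (hp : 0 < p) (hs : 0 < s) :
    pPolar p s '' (Set.Ioo (0 : ℝ) 1 ×ˢ Set.Ioo (0 : ℝ) 1) =
      {ξ : ℝ × ℝ | pnorm p ξ ^ p < s} ∩ Set.Ioi 0 ×ˢ Set.Ioi 0 := by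
  ext w
  constructor
  · rintro ⟨z, hz, rfl⟩
    refine ⟨?_, pPolar_pos hs hz⟩
    rw [Set.mem_ofPred_eq, pnorm_pPolar_rpow hp hs hz]
    exact mul_lt_of_lt_one_right hs (rpow_lt_one hz.1.1.le hz.1.2 hp)
  · rintro ⟨hw, hu, hv⟩
    rw [Set.mem_Ioi] at hu hv
    rw [Set.mem_ofPred_eq, pnorm_rpow hp.ne', abs_of_pos hu, abs_of_pos hv] at hw
    have hu' := rpow_pos_of_pos hu p
    have hv' := rpow_pos_of_pos hv p
    have ht : w.1 ^ p / (w.1 ^ p + w.2 ^ p) ∈ Set.Ioo (0 : ℝ) 1 :=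
      ⟨by positivity, by rw [div_lt_one (by positivity)]; linarith⟩
    have hr : ((w.1 ^ p + w.2 ^ p) / s) ^ (1 / p) ∈ Set.Ioo (0 : ℝ) 1 :=
      ⟨by positivity, rpow_lt_one (by positivity) (by rwa [div_lt_one hs]) (by positivity)⟩
    refine ⟨(_, _), ⟨hr, ht⟩, ?_⟩
    have hpos := pPolar_pos (p := p) hs (z := (_, _)) ⟨hr, ht⟩
    have hpow := pPolar_rpow hp hs (z := (_, _)) ⟨hr, ht⟩
    rw [← rpow_mul (by positivity), one_div_mul_cancel hp.ne', rpow_one] at hpow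
    refine Prod.ext ((rpow_left_inj hpos.1.le hu.le hp.ne').1 (hpow.1.trans ?_))
      ((rpow_left_inj hpos.2.le hv.le hp.ne').1 (hpow.2.trans ?_))
    · field_simp
    · field_simp
      ring

theorem integrableOn_pPolar_weight {p β : ℝ} (hp : 0 < p) (hβ : -1 < β) :
    IntegrableOn (fun z : ℝ × ℝ =>
      z.1 * (1 - z.1 ^ p) ^ β * (z.2 ^ (1 / p - 1) * (1 - z.2) ^ (1 / p - 1)))
      (Set.Ioo (0 : ℝ) 1 ×ˢ Set.Ioo (0 : ℝ) 1) := by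
  have ha : -1 < 1 / p - 1 := by linarith [one_div_pos.2 hp]
  rw [IntegrableOn, Measure.volume_eq_prod, ← Measure.prod_restrict]
  exact (integrableOn_mul_one_sub_rpow_rpow hp hβ).mul_prod
    (integrableOn_rpow_mul_one_sub_rpow ha ha)

theorem continuous_pPolar {p : ℝ} (hp : 0 < p) (s : ℝ) : Continuous (pPolar p s) := by
  have h : 0 ≤ 1 / p := by positivity
  have h1 : Continuous fun z : ℝ × ℝ => z.2 ^ (1 / p) :=
    continuous_snd.rpow_const fun _ => Or.inr h
  have h2 : Continuous fun z : ℝ × ℝ => (1 - z.2) ^ (1 / p) :=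
    (continuous_const.sub continuous_snd).rpow_const fun _ => Or.inr h
  unfold pPolar
  fun_prop

theorem integrableOn_pPolar_weight_mul {p β : ℝ} (hp : 0 < p) (hβ : -1 < β) (s : ℝ)
    {𝕜 : Type*} [RCLike 𝕜] {h : ℝ × ℝ → 𝕜} (hc : Continuous h) {C : ℝ} (hC : ∀ ξ, ‖h ξ‖ ≤ C) :
    IntegrableOn (fun z : ℝ × ℝ =>
      ((z.1 * (1 - z.1 ^ p) ^ β * (z.2 ^ (1 / p - 1) * (1 - z.2) ^ (1 / p - 1)) : ℝ) : 𝕜) *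
        h (pPolar p s z)) (Set.Ioo (0 : ℝ) 1 ×ˢ Set.Ioo (0 : ℝ) 1) :=
  (integrableOn_pPolar_weight hp hβ).ofReal.mul_bdd
    (hc.comp (continuous_pPolar hp s)).aestronglyMeasurable (Filter.Eventually.of_forall fun _ => hC _)

theorem abs_det_smul_weight {p β s : ℝ} (hp : 0 < p) (hs : 0 < s) (h : ℝ × ℝ → ℂ) {z : ℝ × ℝ}
    (hz : z ∈ Set.Ioo (0 : ℝ) 1 ×ˢ Set.Ioo (0 : ℝ) 1) :
    |(fderivPPolar p s z).det| •
        ((((s - pnorm p (pPolar p s z) ^ p) ^ β : ℝ) : ℂ) * h (pPolar p s z)) =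
      ((s ^ (β + 2 / p) / p : ℝ) : ℂ) *
        (((z.1 * (1 - z.1 ^ p) ^ β * (z.2 ^ (1 / p - 1) * (1 - z.2) ^ (1 / p - 1)) : ℝ) : ℂ) *
        h (pPolar p s z)) := by
  have h1 : 0 ≤ 1 - z.1 ^ p := by linarith [rpow_lt_one hz.1.1.le hz.1.2 hp]
  rw [abs_det_fderivPPolar hp hs hz, pnorm_pPolar_rpow hp hs hz, ← mul_one_sub,
    mul_rpow hs.le h1, rpow_add hs, Complex.real_smul]
  push_cast
  ring

theorem integrableOn_weight_mul {p β s : ℝ} (hp : 0 < p) (hβ : -1 < β) (hs : 0 < s)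
    {h : ℝ × ℝ → ℂ} (hc : Continuous h) {C : ℝ} (hC : ∀ ξ, ‖h ξ‖ ≤ C) :
    IntegrableOn (fun ξ : ℝ × ℝ => (((s - pnorm p ξ ^ p) ^ β : ℝ) : ℂ) * h ξ)
      ({ξ : ℝ × ℝ | pnorm p ξ ^ p < s} ∩ Set.Ioi 0 ×ˢ Set.Ioi 0) := by
  have hm : MeasurableSet (Set.Ioo (0 : ℝ) 1 ×ˢ Set.Ioo (0 : ℝ) 1) :=
    measurableSet_Ioo.prod measurableSet_Ioo
  rw [← image_pPolar hp hs, integrableOn_image_iff_integrableOn_abs_det_fderiv_smul volume hm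
    (fun z hz => (hasFDerivAt_pPolar p s hz).hasFDerivWithinAt) (injOn_pPolar hp hs)]
  exact IntegrableOn.congr_fun ((integrableOn_pPolar_weight_mul hp hβ s hc hC).const_mul _)
    (fun z hz => (abs_det_smul_weight hp hs h hz).symm) hm

theorem setIntegral_weight_mul {p β s : ℝ} (hp : 0 < p) (hs : 0 < s) (h : ℝ × ℝ → ℂ) :
    ∫ ξ in {ξ : ℝ × ℝ | pnorm p ξ ^ p < s} ∩ Set.Ioi 0 ×ˢ Set.Ioi 0,
        (((s - pnorm p ξ ^ p) ^ β : ℝ) : ℂ) * h ξ =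
      ((s ^ (β + 2 / p) / p : ℝ) : ℂ) * ∫ z in Set.Ioo (0 : ℝ) 1 ×ˢ Set.Ioo (0 : ℝ) 1,
        ((z.1 * (1 - z.1 ^ p) ^ β * (z.2 ^ (1 / p - 1) * (1 - z.2) ^ (1 / p - 1)) : ℝ) : ℂ) *
          h (pPolar p s z) := by
  have hm : MeasurableSet (Set.Ioo (0 : ℝ) 1 ×ˢ Set.Ioo (0 : ℝ) 1) :=
    measurableSet_Ioo.prod measurableSet_Ioo
  rw [← image_pPolar hp hs, integral_image_eq_integral_abs_det_fderiv_smul volume hm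
    (fun z hz => (hasFDerivAt_pPolar p s hz).hasFDerivWithinAt) (injOn_pPolar hp hs),
    ← integral_const_mul]
  exact setIntegral_congr_fun hm fun z hz => abs_det_smul_weight hp hs h hz

theorem e2πi_sum_signs (a b : ℝ) :
    e2πi (a + b) + e2πi (a - b) + (e2πi (-a + b) + e2πi (-a - b)) =
      ((4 * (cos (2 * π * a) * cos (2 * π * b)) : ℝ) : ℂ) := by
  simp only [e2πi]
  push_cast
  rw [Complex.cos, Complex.cos]
  simp only [mul_add, mul_neg, add_mul, neg_mul, sub_eq_add_neg, Complex.exp_add]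
  ring

theorem norm_e2πi (θ : ℝ) : ‖e2πi θ‖ = 1 := Complex.norm_exp_ofReal_mul_I _

theorem continuous_e2πi : Continuous e2πi := by
  unfold e2πi
  fun_prop

theorem setIntegral_ball_eq {p β s : ℝ} (hp : 0 < p) (hβ : -1 < β) (hs : 0 < s) (x : ℝ × ℝ) :
    ∫ ξ in {ξ : ℝ × ℝ | pnorm p ξ ^ p < s},
        (((s - pnorm p ξ ^ p) ^ β : ℝ) : ℂ) * e2πi (x.1 * ξ.1 + x.2 * ξ.2) =
      ((s ^ (β + 2 / p) / p * ∫ z in Set.Ioo (0 : ℝ) 1 ×ˢ Set.Ioo (0 : ℝ) 1,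
        z.1 * (1 - z.1 ^ p) ^ β * (z.2 ^ (1 / p - 1) * (1 - z.2) ^ (1 / p - 1)) *
          (4 * (cos (2 * π * (x.1 * (pPolar p s z).1)) *
            cos (2 * π * (x.2 * (pPolar p s z).2)))) : ℝ) : ℂ) := by
  have habs : ∀ ε δ : ℝ, |ε| = 1 → |δ| = 1 → ∀ z : ℝ × ℝ,
      pnorm p (ε * z.1, δ * z.2) = pnorm p z := by
    intro ε δ hε hδ z
    simp only [pnorm, abs_mul, hε, hδ, one_mul]
  have hn₁ : ∀ u v : ℝ, pnorm p (-u, v) = pnorm p (u, v) := fun u v => by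
    simp only [pnorm, abs_neg]
  have hn₂ : ∀ u v : ℝ, pnorm p (u, -v) = pnorm p (u, v) := fun u v => by
    simp only [pnorm, abs_neg]
  have hA : MeasurableSet {ξ : ℝ × ℝ | pnorm p ξ ^ p < s} := by
    refine measurableSet_lt ?_ measurable_const
    unfold pnorm
    fun_prop
  rw [setIntegral_eq_quadrant hA (fun u v => by simp only [Set.mem_ofPred_eq, hn₁])
    (fun u v => by simp only [Set.mem_ofPred_eq, hn₂]) ?_]
  · simp only [hn₁, hn₂, Prod.mk.eta, ← mul_add]
    rw [Complex.ofReal_mul, ← integral_complex_ofReal]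
    refine Eq.trans (setIntegral_congr_fun (hA.inter (measurableSet_Ioi.prod measurableSet_Ioi))
      fun ξ _ => ?_) ((setIntegral_weight_mul (β := β) hp hs (fun ξ : ℝ × ℝ =>
        ((4 * (cos (2 * π * (x.1 * ξ.1)) * cos (2 * π * (x.2 * ξ.2))) : ℝ) : ℂ))).trans ?_)
    · simp only [mul_neg, ← sub_eq_add_neg, e2πi_sum_signs]
    · simp only [Complex.ofReal_mul]
  · intro ε δ hε hδ
    simp only [habs ε δ hε hδ]
    refine integrableOn_weight_mul hp hβ hs (h := fun z => e2πi (x.1 * (ε * z.1) + x.2 * (δ * z.2)))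
      (continuous_e2πi.comp (by fun_prop)) (C := 1) fun _ => (norm_e2πi _).le

theorem integral_Jzero_eq {p β : ℝ} (hp : 0 < p) (hβ : -1 < β) (s : ℝ) (x : ℝ × ℝ) :
    ∫ τ in (0 : ℝ)..1, Jzero p (τ * (2 * π * s ^ (1 / p) * x.1), τ * (2 * π * s ^ (1 / p) * x.2)) *
        τ * (1 - τ ^ p) ^ β =
      1 / Real.Gamma (1 / p) ^ 2 / p ^ 2 * ∫ z in Set.Ioo (0 : ℝ) 1 ×ˢ Set.Ioo (0 : ℝ) 1,
        z.1 * (1 - z.1 ^ p) ^ β * (z.2 ^ (1 / p - 1) * (1 - z.2) ^ (1 / p - 1)) *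
          (4 * (cos (2 * π * (x.1 * (pPolar p s z).1)) *
            cos (2 * π * (x.2 * (pPolar p s z).2)))) := by
  have hint := integrableOn_pPolar_weight_mul (𝕜 := ℝ) hp hβ s (C := 4) (h := fun ξ : ℝ × ℝ =>
    4 * (cos (2 * π * (x.1 * ξ.1)) * cos (2 * π * (x.2 * ξ.2)))) (by fun_prop) (fun ξ => by
      rw [norm_mul, norm_mul, norm_of_nonneg (by norm_num : (0 : ℝ) ≤ 4)]
      have := mul_le_one₀ (abs_cos_le_one (2 * π * (x.1 * ξ.1))) (abs_nonneg _)
        (abs_cos_le_one (2 * π * (x.2 * ξ.2)))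
      simp only [norm_eq_abs]
      linarith)
  have hint' := setIntegral_prod _ hint
  rw [← Measure.volume_eq_prod] at hint'
  simp only [RCLike.ofReal_real_eq_id, id] at hint'
  rw [hint', intervalIntegral.integral_of_le zero_le_one, integral_Ioc_eq_integral_Ioo,
    ← integral_const_mul]
  refine setIntegral_congr_fun measurableSet_Ioo fun τ _ => ?_
  simp only [Jzero]
  rw [intervalIntegral.integral_of_le zero_le_one, integral_Ioc_eq_integral_Ioo,
    ← integral_const_mul, ← integral_const_mul, ← integral_mul_const, ← integral_mul_const]
  refine setIntegral_congr_fun measurableSet_Ioo fun t _ => ?_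
  simp only [pPolar]
  rw [show 2 * π * (x.1 * (s ^ (1 / p) * (τ * t ^ (1 / p)))) =
      τ * (2 * π * s ^ (1 / p) * x.1) * t ^ (1 / p) by ring,
    show 2 * π * (x.2 * (s ^ (1 / p) * (τ * (1 - t) ^ (1 / p)))) =
      τ * (2 * π * s ^ (1 / p) * x.2) * (1 - t) ^ (1 / p) by ring]
  ring

/-- Representation of `𝒟_β^[p]` by the generalized Bessel function `J_{β+1}^[p]`. -/
theorem Dcal_eq_Jord (p β : ℝ) (hp : 0 < p) (hβ : -1 < β) :
    ∀ s : ℝ, 0 < s → ∀ x : ℝ × ℝ, x ≠ 0 →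
      Dcal p β s x =
        ((s ^ (β + 2 / p) * p ^ (β + 1) * Real.Gamma (1 / p) ^ 2 *
          (Jord p (β + 1) (2 * Real.pi * s ^ (1 / p) * x.1, 2 * Real.pi * s ^ (1 / p) * x.2) /
            (2 * Real.pi * s ^ (1 / p) * pnorm p x) ^ (β + 1)) : ℝ) : ℂ) := by

  intro s hs x hx
  have hc : 0 < 2 * π * s ^ (1 / p) := by positivity
  have hnorm := mul_pos hc (pnorm_pos (p := p) hx)
  have hne := (rpow_pos_of_pos hnorm (β + 1)).ne'
  have hΓ := (Gamma_pos_of_pos (by linarith : 0 < β + 1)).ne'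
  have hΓ' := (Gamma_pos_of_pos (one_div_pos.2 hp)).ne'
  have hpβ := (rpow_pos_of_pos hp β).ne'
  rw [Dcal, setIntegral_ball_eq hp hβ hs x, ← Complex.ofReal_mul, Jord, pnorm_mul hp.ne' hc.le,
    add_sub_cancel_right, integral_Jzero_eq hp hβ s x, rpow_add_one hp.ne']
  congr 1
  generalize (∫ z in Set.Ioo (0 : ℝ) 1 ×ˢ Set.Ioo (0 : ℝ) 1, _ : ℝ) = I
  field_simp
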